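/- arXiv:2508.00488 — 2 statements merged into one kernel-verified Lean document; each statement's English description precedes it below -/
import Mathlib

section
/- In St ⊗_k St the following identities hold for all x, y ∈ F with x ≠ y: for all t ∈ F* and z ∈ F, h(t)·ρ_{x,y} = ρ_{t²x, t²y} and ε(z)·ρ_{x,y} = ρ_{z+x, z+y}; moreover for all x, y ∈ F* with x ≠ y one has s·ρ_{x,y} = ρ_{−x^{-1}, −y^{-1}} − ρ_{−x^{-1}, 0} + ρ_{−y^{-1}, 0}, and for all x ∈ F* one has s·ρ_{x,0} = −ρ_{−x^{-1}, 0}. -/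
noncomputable section

open scoped TensorProduct

namespace SL2X

variable (p : ℕ) [Fact p.Prime]

/-- The algebraic closure of the prime field `𝔽_p`. -/
abbrev F : Type := AlgebraicClosure (ZMod p)

/-- `G = SL₂(F)`. -/
abbrev G : Type := Matrix.SpecialLinearGroup (Fin 2) (F p)

/-- The unipotent element `ε(x) = [[1,x],[0,1]]`. -/
def eps (x : F p) : G p :=
  ⟨!![1, x; 0, 1], by simp [Matrix.det_fin_two_of]⟩

/-- The torus element `h(t) = diag(t, t⁻¹)`. -/
def h (t : (F p)ˣ) : G p :=
  ⟨!![(t : F p), 0; 0, ((t⁻¹ : (F p)ˣ) : F p)], by simp [Matrix.det_fin_two_of]⟩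

/-- The Weyl element `s = [[0,1],[-1,0]]`. -/
def sG : G p :=
  ⟨!![0, 1; -1, 0], by simp [Matrix.det_fin_two_of]⟩

/-- The Borel subgroup `B` of upper triangular matrices in `G`. -/
def B : Subgroup (G p) where
  carrier := {g | (g : Matrix (Fin 2) (Fin 2) (F p)) 1 0 = 0}
  one_mem' := by simp [Matrix.one_apply]
  mul_mem' := by
    intro a b ha hb
    simp only [Set.mem_setOf_eq] at *
    simp [Matrix.mul_apply, Fin.sum_univ_two, ha, hb]
  inv_mem' := by
    intro a ha
    simp only [Set.mem_setOf_eq] at *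
    simp [Matrix.SpecialLinearGroup.coe_inv, Matrix.adjugate_fin_two, ha]

/-- The diagonal part of an element of `B`, as a unit of `F`. -/
def Bdiag (b : B p) : (F p)ˣ where
  val := ((b : G p) : Matrix (Fin 2) (Fin 2) (F p)) 0 0
  inv := ((b : G p) : Matrix (Fin 2) (Fin 2) (F p)) 1 1
  val_inv := by
    have hdet : ((b : G p) : Matrix (Fin 2) (Fin 2) (F p)).det = 1 := (b : G p).2
    have h10 : ((b : G p) : Matrix (Fin 2) (Fin 2) (F p)) 1 0 = 0 := b.2
    rw [Matrix.det_fin_two, h10, mul_zero, sub_zero] at hdet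
    exact hdet
  inv_val := by
    have hdet : ((b : G p) : Matrix (Fin 2) (Fin 2) (F p)).det = 1 := (b : G p).2
    have h10 : ((b : G p) : Matrix (Fin 2) (Fin 2) (F p)) 1 0 = 0 := b.2
    rw [Matrix.det_fin_two, h10, mul_zero, sub_zero] at hdet
    rw [mul_comm]; exact hdet

variable (k : Type) [Field k] [IsAlgClosed k] [CharZero k]

/-- The group algebra `kG`. -/
abbrev kG : Type := MonoidAlgebra k (G p)

/-- The canonical image of a group element in the group algebra. -/
def γ (g : G p) : kG p k := MonoidAlgebra.of k (G p) g

/-- The submodule of relations defining the induced module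
`M(θ) = kG ⊗_{kB} k_θ`, where the character `θ` of `T ≅ Fˣ` is extended to `B`
by letting `U` act trivially. -/
def Nmod (θ : (F p)ˣ →* kˣ) : Submodule (kG p k) (kG p k) :=
  Submodule.span (kG p k)
    {y | ∃ b : B p, y = γ p k (b : G p) - ((θ (Bdiag p b) : k)) • (1 : kG p k)}

/-- The induced module `M(θ) = kG ⊗_{kB} k_θ`, realized as `kG / N(θ)` where
`N(θ)` is the left submodule generated by the elements `b - θ(b)·1`, `b ∈ B`. -/
def Mmod (θ : (F p)ˣ →* kˣ) : Type := kG p k ⧸ Nmod p k θ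

instance (θ : (F p)ˣ →* kˣ) : AddCommGroup (Mmod p k θ) :=
  inferInstanceAs (AddCommGroup (kG p k ⧸ Nmod p k θ))
instance (θ : (F p)ˣ →* kˣ) : Module (kG p k) (Mmod p k θ) :=
  inferInstanceAs (Module (kG p k) (kG p k ⧸ Nmod p k θ))
instance (θ : (F p)ˣ →* kˣ) : Module k (Mmod p k θ) :=
  inferInstanceAs (Module k (kG p k ⧸ Nmod p k θ))
instance (θ : (F p)ˣ →* kˣ) : IsScalarTower k (kG p k) (Mmod p k θ) :=
  inferInstanceAs (IsScalarTower k (kG p k) (kG p k ⧸ Nmod p k θ))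

/-- The canonical generator `1_θ ∈ M(θ)`. -/
def oneθ (θ : (F p)ˣ →* kˣ) : Mmod p k θ :=
  Submodule.Quotient.mk (1 : kG p k)

/-- `η = (1 - s)·1_tr ∈ M(tr)`. -/
def eta : Mmod p k 1 :=
  Submodule.Quotient.mk ((1 : kG p k) - γ p k (sG p))

/-- The Steinberg module `St = kG·η ⊆ M(tr)`. -/
def St : Submodule (kG p k) (Mmod p k 1) :=
  Submodule.span (kG p k) {eta p k}

/-- `ε(x)·η` as an element of `St`. -/
def E (x : F p) : ↥(St p k) :=
  ⟨γ p k (eps p x) • eta p k,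
    Submodule.smul_mem _ _ (Submodule.mem_span_singleton_self _)⟩

/-- The action of a group element on `St`, as a `k`-linear map. -/
def gSt (g : G p) : ↥(St p k) →ₗ[k] ↥(St p k) where
  toFun v := ⟨γ p k g • (v : Mmod p k 1), Submodule.smul_mem _ _ v.2⟩
  map_add' := by intro a b; apply Subtype.ext; simp [smul_add]
  map_smul' := by
    intro c v; apply Subtype.ext
    simp [smul_comm (γ p k g) c]

/-- `St ⊗_k St`. -/
abbrev StT : Type := ↥(St p k) ⊗[k] ↥(St p k)

/-- The diagonal action of a group element on `St ⊗_k St`. -/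
def gTT (g : G p) : StT p k →ₗ[k] StT p k :=
  TensorProduct.map (gSt p k g) (gSt p k g)

/-- `ω_{x,y} = (ε(x)η ⊗ ε(y)η + ε(y)η ⊗ ε(x)η)/2`. -/
def ω (x y : F p) : StT p k :=
  (2 : k)⁻¹ • (E p k x ⊗ₜ[k] E p k y + E p k y ⊗ₜ[k] E p k x)

/-- `ρ_{x,y} = (ε(x)η ⊗ ε(y)η − ε(y)η ⊗ ε(x)η)/2`. -/
def ρ (x y : F p) : StT p k :=
  (2 : k)⁻¹ • (E p k x ⊗ₜ[k] E p k y - E p k y ⊗ₜ[k] E p k x)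

/-- `V₊`, the span of the `ω_{x,y}`. -/
def Vplus : Submodule k (StT p k) :=
  Submodule.span k {v | ∃ x y : F p, v = ω p k x y}

/-- `V₋`, the span of the `ρ_{x,y}` for `x ≠ y`. -/
def Vminus : Submodule k (StT p k) :=
  Submodule.span k {v | ∃ x y : F p, x ≠ y ∧ v = ρ p k x y}


lemma coe_eps (x : F p) : (eps p x : Matrix (Fin 2) (Fin 2) (F p)) = !![1, x; 0, 1] := rfl

lemma coe_h (t : (F p)ˣ) :
    (h p t : Matrix (Fin 2) (Fin 2) (F p)) = !![(t : F p), 0; 0, ((t⁻¹ : (F p)ˣ) : F p)] := rfl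

lemma coe_sG : (sG p : Matrix (Fin 2) (Fin 2) (F p)) = !![0, 1; -1, 0] := rfl

/-- The class `g · 1_tr` of a group element in `M(tr)`. -/
def coset (g : G p) : Mmod p k 1 :=
  Submodule.Quotient.mk (γ p k g)

lemma γ_mul (g g' : G p) : γ p k (g * g') = γ p k g * γ p k g' :=
  map_mul (MonoidAlgebra.of k (G p)) g g'

lemma smul_coset (g g' : G p) : γ p k g • coset p k g' = coset p k (g * g') := by
  rw [coset, coset, γ_mul]
  rfl

lemma coset_mul_borel (g : G p) (b : B p) : coset p k (g * b) = coset p k g := by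
  refine (Submodule.Quotient.eq _).2 ?_
  have hb : γ p k (b : G p) - 1 ∈ Nmod p k 1 :=
    Submodule.subset_span ⟨b, by simp⟩
  have := (Nmod p k 1).smul_mem (γ p k g) hb
  rwa [smul_eq_mul, mul_sub, mul_one, ← γ_mul] at this

/-- Group elements with proportional first columns have the same class. -/
lemma coset_eq_of_col {g g' : G p} (hg : g 0 0 * g' 1 0 = g' 0 0 * g 1 0) :
    coset p k g = coset p k g' := by
  have hb : g'⁻¹ * g ∈ B p := by
    change (g'⁻¹ * g) 1 0 = 0
    simp [Matrix.SpecialLinearGroup.coe_inv, Matrix.adjugate_fin_two, Matrix.mul_apply,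
      Fin.sum_univ_two]
    linear_combination -hg
  simpa using coset_mul_borel p k g' ⟨_, hb⟩

lemma eta_eq : eta p k = coset p k 1 - coset p k (sG p) := by
  have h1 : γ p k 1 = 1 := map_one (MonoidAlgebra.of k (G p))
  rw [coset, coset, h1]
  rfl

lemma smul_E (g : G p) (x : F p) :
    γ p k g • (E p k x : Mmod p k 1) =
      coset p k (g * eps p x) - coset p k (g * (eps p x * sG p)) := by
  change γ p k g • γ p k (eps p x) • eta p k = _
  rw [eta_eq, smul_sub, smul_sub, smul_coset, smul_coset, smul_coset, smul_coset, mul_one]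

lemma coe_E (x : F p) :
    (E p k x : Mmod p k 1) = coset p k 1 - coset p k (eps p x * sG p) := by
  change γ p k (eps p x) • eta p k = _
  rw [eta_eq, smul_sub, smul_coset, smul_coset, mul_one]
  congr 1
  apply coset_eq_of_col
  simp [coe_eps]

lemma gSt_h_E (t : (F p)ˣ) (x : F p) :
    gSt p k (h p t) (E p k x) = E p k ((t : F p) ^ 2 * x) := by
  apply Subtype.ext
  change γ p k (h p t) • (E p k x : Mmod p k 1) = _
  rw [smul_E, coe_E]
  congr 1 <;> apply coset_eq_of_col
  · simp [coe_eps, coe_h]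
  · simp [coe_eps, coe_h, coe_sG]
    field_simp

lemma gSt_eps_E (z x : F p) : gSt p k (eps p z) (E p k x) = E p k (z + x) := by
  apply Subtype.ext
  change γ p k (eps p z) • (E p k x : Mmod p k 1) = _
  rw [smul_E, coe_E]
  congr 1 <;> apply coset_eq_of_col
  · simp [coe_eps]
  · simp [coe_eps, coe_sG]

lemma gSt_s_E_zero : gSt p k (sG p) (E p k 0) = -E p k 0 := by
  apply Subtype.ext
  change γ p k (sG p) • (E p k 0 : Mmod p k 1) = -(E p k 0 : Mmod p k 1)
  rw [smul_E, coe_E, neg_sub]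
  congr 1 <;> apply coset_eq_of_col <;>
    simp [coe_eps, coe_sG]

lemma gSt_s_E {x : F p} (hx : x ≠ 0) :
    gSt p k (sG p) (E p k x) = E p k (-x⁻¹) - E p k 0 := by
  apply Subtype.ext
  change γ p k (sG p) • (E p k x : Mmod p k 1) =
    (E p k (-x⁻¹) : Mmod p k 1) - (E p k 0 : Mmod p k 1)
  rw [smul_E, coe_E, coe_E, sub_sub_sub_cancel_left]
  congr 1 <;> apply coset_eq_of_col <;>
    simp [coe_eps, coe_sG, hx]

lemma gTT_ρ (g : G p) (x y : F p) :
    gTT p k g (ρ p k x y) = (2 : k)⁻¹ •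
      (gSt p k g (E p k x) ⊗ₜ[k] gSt p k g (E p k y) -
        gSt p k g (E p k y) ⊗ₜ[k] gSt p k g (E p k x)) := by
  simp only [gTT, ρ, map_smul, map_sub, TensorProduct.map_tmul]

lemma smul_tmul_sub_sub {R V : Type*} [CommRing R] [AddCommGroup V] [Module R V]
    (r : R) (a b c : V) :
    r • ((a - c) ⊗ₜ[R] (b - c) - (b - c) ⊗ₜ[R] (a - c)) =
      r • (a ⊗ₜ[R] b - b ⊗ₜ[R] a) - r • (a ⊗ₜ[R] c - c ⊗ₜ[R] a) +
        r • (b ⊗ₜ[R] c - c ⊗ₜ[R] b) := by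
  rw [← smul_sub, ← smul_add]
  congr 1
  simp only [TensorProduct.sub_tmul, TensorProduct.tmul_sub]
  abel

lemma smul_tmul_sub_neg {R V : Type*} [CommRing R] [AddCommGroup V] [Module R V]
    (r : R) (a c : V) :
    r • ((a - c) ⊗ₜ[R] (-c) - (-c) ⊗ₜ[R] (a - c)) = -(r • (a ⊗ₜ[R] c - c ⊗ₜ[R] a)) := by
  rw [← smul_neg]
  congr 1
  simp only [TensorProduct.sub_tmul, TensorProduct.tmul_sub, TensorProduct.neg_tmul,
    TensorProduct.tmul_neg]
  abel

/-- the action of `h(t)`, `ε(z)` and `s` on the elements `ρ_{x,y}`. -/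
theorem stmt3 (hp2 : p ≠ 2) :
    (∀ (x y : F p), x ≠ y → ∀ t : (F p)ˣ,
      gTT p k (h p t) (ρ p k x y) = ρ p k ((t : F p) ^ 2 * x) ((t : F p) ^ 2 * y)) ∧
    (∀ (x y : F p), x ≠ y → ∀ z : F p,
      gTT p k (eps p z) (ρ p k x y) = ρ p k (z + x) (z + y)) ∧
    (∀ x y : F p, x ≠ 0 → y ≠ 0 → x ≠ y →
      gTT p k (sG p) (ρ p k x y) =
        ρ p k (-x⁻¹) (-y⁻¹) - ρ p k (-x⁻¹) 0 + ρ p k (-y⁻¹) 0) ∧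
    (∀ x : F p, x ≠ 0 →
      gTT p k (sG p) (ρ p k x 0) = -ρ p k (-x⁻¹) 0) := by
  refine ⟨fun x y _ t => ?_, fun x y _ z => ?_, fun x y hx hy _ => ?_, fun x hx => ?_⟩
  · rw [gTT_ρ, gSt_h_E, gSt_h_E, ρ]
  · rw [gTT_ρ, gSt_eps_E, gSt_eps_E, ρ]
  · rw [gTT_ρ, gSt_s_E p k hx, gSt_s_E p k hy]
    exact smul_tmul_sub_sub _ _ _ _
  · rw [gTT_ρ, gSt_s_E p k hx, gSt_s_E_zero]
    exact smul_tmul_sub_neg _ _ _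

end SL2X
end
end

section
/- Every kG-module endomorphism of V₋ is a scalar multiple of the identity, i.e., End_{kG}(V₋) ≅ k; consequently the kG-module V₋ is indecomposable. -/
noncomputable section

open scoped TensorProduct

namespace SL2X

variable (p : ℕ) [Fact p.Prime]

variable (k : Type) [Field k] [IsAlgClosed k] [CharZero k]

set_option linter.unusedSectionVars false

lemma SL_mul_apply {R : Type*} [CommRing R] (g g' : Matrix.SpecialLinearGroup (Fin 2) R)
    (i j : Fin 2) : (g * g') i j = g i 0 * g' 0 j + g i 1 * g' 1 j := by
  simp [Matrix.SpecialLinearGroup.coe_mul, Matrix.mul_apply, Fin.sum_univ_two]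

lemma eps_apply (x : F p) : eps p x 0 0 = 1 ∧ eps p x 0 1 = x ∧ eps p x 1 0 = 0 ∧
    eps p x 1 1 = 1 := by
  simp [eps]

lemma sG_apply : sG p 0 0 = 0 ∧ sG p 0 1 = 1 ∧ sG p 1 0 = -1 ∧ sG p 1 1 = 0 := by
  simp [sG]

variable {p} in
/-- The class in `M(tr)` of a group element, i.e. a point of the projective line. -/
def pt (g : G p) : Mmod p k 1 := Submodule.Quotient.mk (γ p k g)

lemma γ_smul_pt (a g : G p) : γ p k a • pt k g = pt k (a * g) := by
  change Submodule.Quotient.mk (γ p k a • γ p k g) = pt k (a * g)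
  rw [smul_eq_mul, γ, γ, ← map_mul]
  rfl

lemma pt_eq_pt {g g' : G p} (hg : g 0 0 * g' 1 0 = g 1 0 * g' 0 0) :
    pt k g = pt k g' := by
  have hb : g⁻¹ * g' ∈ B p := by
    change (g⁻¹ * g').1 1 0 = 0
    simp [Matrix.mul_apply, Fin.sum_univ_two, Matrix.adjugate_fin_two]
    linear_combination hg
  symm
  refine (Submodule.Quotient.eq (Nmod p k 1)).2 ?_
  have key : γ p k g * (γ p k (g⁻¹ * g') - ((1 : (F p)ˣ →* kˣ) (Bdiag p ⟨_, hb⟩) : k) • 1) =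
      γ p k g' - γ p k g := by
    simp [mul_sub, γ, MonoidAlgebra.single_mul_single]
  rw [← key, ← smul_eq_mul]
  exact Submodule.smul_mem _ _ (Submodule.subset_span ⟨⟨_, hb⟩, rfl⟩)

lemma γ_smul_eta (g : G p) : γ p k g • eta p k = pt k g - pt k (g * sG p) := by
  change Submodule.Quotient.mk (γ p k g • (1 - γ p k (sG p))) = _
  rw [smul_sub, smul_eq_mul, smul_eq_mul, mul_one, γ, γ, ← map_mul]
  rfl

open Classical in
/-- The coefficient at the affine point `a` of the projective line, on the group algebra. -/
def coeffKG (a : F p) : kG p k →ₗ[k] k :=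
  (Finsupp.linearCombination k fun g : G p => if g 0 0 = a * g 1 0 then (1 : k) else 0) ∘ₗ
    (MonoidAlgebra.coeffLinearEquiv k).toLinearMap

open Classical in
lemma coeffKG_γ (a : F p) (g : G p) :
    coeffKG p k a (γ p k g) = if g 0 0 = a * g 1 0 then (1 : k) else 0 := by
  simp [coeffKG, γ]

lemma coeffKG_eq_zero (a : F p) {y : kG p k} (hy : y ∈ Nmod p k 1) : coeffKG p k a y = 0 := by
  classical
  suffices H : ∀ c : kG p k, coeffKG p k a (c * y) = 0 by simpa using H 1
  induction hy using Submodule.span_induction with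
  | zero => simp
  | add x y _ _ hx hy => intro c; rw [mul_add, map_add, hx, hy, add_zero]
  | smul d x _ hx => intro c; rw [smul_eq_mul, ← mul_assoc]; exact hx _
  | mem y hy =>
    obtain ⟨b, rfl⟩ := hy
    intro c
    induction c using MonoidAlgebra.induction_on with
    | of g =>
      have hb : (b : G p) 1 0 = 0 := b.2
      have hdet := Matrix.det_fin_two (b : G p).1
      rw [(b : G p).2] at hdet
      have hb0 : (b : G p) 0 0 ≠ 0 := by
        intro h0
        simp [hb, h0] at hdet
      have e : MonoidAlgebra.of k (G p) g *
          (γ p k b - ((1 : (F p)ˣ →* kˣ) (Bdiag p b) : k) • 1) =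
          γ p k (g * b) - γ p k g := by
        simp [mul_sub, γ, MonoidAlgebra.single_mul_single]
      have hiff : (g * (b : G p)) 0 0 = a * (g * (b : G p)) 1 0 ↔ g 0 0 = a * g 1 0 := by
        rw [SL_mul_apply, SL_mul_apply, hb, mul_zero, mul_zero, add_zero, add_zero, ← mul_assoc]
        exact mul_left_inj' hb0
      rw [e, map_sub, coeffKG_γ, coeffKG_γ, if_congr hiff rfl rfl, sub_self]
    | add c d hc hd => rw [add_mul, map_add, hc, hd, add_zero]
    | smul r c hc => rw [smul_mul_assoc, map_smul, hc, smul_zero]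

/-- The coefficient at the affine point `a` of the projective line, on `M(tr)`. -/
def coeffM (a : F p) : Mmod p k 1 →ₗ[k] k :=
  (((Nmod p k 1).restrictScalars k).liftQ (coeffKG p k a)
    fun _ hy => coeffKG_eq_zero p k a hy) ∘ₗ
    (Submodule.Quotient.restrictScalarsEquiv k (Nmod p k 1)).symm.toLinearMap

open Classical in
lemma coeffM_pt (a : F p) (g : G p) :
    coeffM p k a (pt k g) = if g 0 0 = a * g 1 0 then (1 : k) else 0 :=
  coeffKG_γ p k a g

/-- The coordinate on the Steinberg module dual to the basis vector `ε(a)η`. -/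
def coord (a : F p) : St p k →ₗ[k] k :=
  -(coeffM p k a ∘ₗ ((St p k).restrictScalars k).subtype)

lemma gSt_E_coe (g : G p) (x : F p) :
    (gSt p k g (E p k x) : Mmod p k 1) = pt k (g * eps p x) - pt k (g * eps p x * sG p) := by
  change γ p k g • γ p k (eps p x) • eta p k = _
  rw [γ_smul_eta, smul_sub, γ_smul_pt, γ_smul_pt, mul_assoc]

lemma E_coe (x : F p) :
    (E p k x : Mmod p k 1) = pt k (eps p x) - pt k (eps p x * sG p) :=
  γ_smul_eta p k _

open Classical in
lemma coord_gSt_E (a x : F p) (g : G p) :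
    coord p k a (gSt p k g (E p k x)) =
      (if x * g 0 0 + g 0 1 = a * (x * g 1 0 + g 1 1) then 1 else 0) -
        if g 0 0 = a * g 1 0 then 1 else 0 := by
  change -coeffM p k a (gSt p k g (E p k x) : Mmod p k 1) = _
  rw [gSt_E_coe, map_sub, coeffM_pt, coeffM_pt, neg_sub]
  have : ∀ u v w z : F p, -w + -(u * x) = a * (-z + -(v * x)) ↔ x * u + w = a * (x * v + z) := by
    intro u v w z
    constructor <;> intro h <;> linear_combination -h
  simp only [SL_mul_apply]
  simp [eps_apply, sG_apply, this]

open Classical in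
lemma coord_E (a x : F p) : coord p k a (E p k x) = if x = a then 1 else 0 := by
  change -coeffM p k a (E p k x : Mmod p k 1) = _
  rw [E_coe, map_sub, coeffM_pt, coeffM_pt, neg_sub]
  simp only [SL_mul_apply]
  simp [eps_apply, sG_apply]

lemma exists_affine {x y : F p} (hxy : x ≠ y) :
    ∃ g : G p, gSt p k g (E p k 0) = E p k x ∧ gSt p k g (E p k 1) = E p k y ∧
      ∀ a s, coord p k a (gSt p k g (E p k s)) ≠ 0 → x + (y - x) * s = a := by
  obtain ⟨t, ht⟩ := IsAlgClosed.exists_pow_nat_eq (y - x) (n := 2) (by norm_num)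
  have ht0 : t ≠ 0 := by
    rintro rfl
    exact hxy (sub_eq_zero.1 (by linear_combination -ht)).symm
  let g : G p := ⟨!![t, x * t⁻¹; 0, t⁻¹], by simp [Matrix.det_fin_two_of, ht0]⟩
  have g00 : g 0 0 = t := rfl
  have g01 : g 0 1 = x * t⁻¹ := rfl
  have g10 : g 1 0 = 0 := rfl
  have g11 : g 1 1 = t⁻¹ := rfl
  refine ⟨g, ?_, ?_, fun a s h => ?_⟩
  · apply Subtype.ext
    rw [gSt_E_coe, E_coe]
    congr 1 <;> apply pt_eq_pt <;> simp only [SL_mul_apply] <;>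
      simp [eps_apply, sG_apply, g00, g01, g10, g11]
    ring
  · apply Subtype.ext
    rw [gSt_E_coe, E_coe]
    congr 1 <;> apply pt_eq_pt <;> simp only [SL_mul_apply] <;>
      simp [eps_apply, sG_apply, g00, g01, g10, g11]
    field_simp
    linear_combination ht
  · contrapose! h
    rw [coord_gSt_E, g00, g01, g10, g11, if_neg, if_neg, sub_zero]
    · simpa using ht0
    · intro e
      apply h
      field_simp at e
      linear_combination e - s * ht

lemma exists_moebius {x : F p} (hx0 : x ≠ 0) (hx1 : x ≠ 1) :
    ∃ g : G p, gSt p k g (E p k 0) = E p k 0 - E p k x ∧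
      gSt p k g (E p k 1) = E p k 1 - E p k x ∧
      ∀ a s, a ≠ x → coord p k a (gSt p k g (E p k s)) ≠ 0 → s * x = a * (s + x - 1) := by
  have hx : x * (x - 1) ≠ 0 := mul_ne_zero hx0 (sub_ne_zero.2 hx1)
  obtain ⟨r, hr⟩ := IsAlgClosed.exists_pow_nat_eq (x * (x - 1))⁻¹ (n := 2) (by norm_num)
  have hr0 : r ≠ 0 := by
    rintro rfl
    exact inv_ne_zero hx (by linear_combination -hr)
  let g : G p := ⟨!![r * x, 0; r, r * (x - 1)], by
    rw [Matrix.det_fin_two_of]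
    linear_combination x * (x - 1) * hr + inv_mul_cancel₀ hx⟩
  have g00 : g 0 0 = r * x := rfl
  have g01 : g 0 1 = 0 := rfl
  have g10 : g 1 0 = r := rfl
  have g11 : g 1 1 = r * (x - 1) := rfl
  have key : ∀ y, y * x = y * (y + x - 1) → gSt p k g (E p k y) = E p k y - E p k x := by
    intro y hy
    apply Subtype.ext
    rw [Submodule.coe_sub, gSt_E_coe, E_coe, E_coe]
    have h1 : pt k (g * eps p y) = pt k (eps p x * sG p) := by
      apply pt_eq_pt
      simp only [SL_mul_apply]
      simp [eps_apply, sG_apply, g00, g01, g10, g11]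
    have h2 : pt k (g * eps p y * sG p) = pt k (eps p y * sG p) := by
      apply pt_eq_pt
      simp only [SL_mul_apply]
      simp [eps_apply, sG_apply, g00, g01, g10, g11]
      linear_combination r * hy
    have h3 : pt k (eps p y) = pt k (eps p x) := by
      apply pt_eq_pt
      simp [eps_apply]
    rw [h1, h2, h3]
    abel
  refine ⟨g, key 0 (by ring), key 1 (by ring), fun a s hax h => ?_⟩
  contrapose! h
  rw [coord_gSt_E, g00, g01, g10, g11, if_neg, if_neg, sub_zero]
  · intro e
    exact hax (mul_left_cancel₀ hr0 (by linear_combination -e))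
  · intro e
    exact h (mul_left_cancel₀ hr0 (by linear_combination e))

/-- The coefficient of `ε(a)η ⊗ ε(b)η`. -/
def coord₂ (a b : F p) : StT p k →ₗ[k] k :=
  LinearMap.mul' k k ∘ₗ TensorProduct.map (coord p k a) (coord p k b)

lemma coord₂_tmul (a b : F p) (u v : St p k) :
    coord₂ p k a b (u ⊗ₜ[k] v) = coord p k a u * coord p k b v := by
  simp [coord₂]

lemma sub_mem_StT {W : Submodule k (StT p k)} {u v : StT p k} (hu : u ∈ W) (hv : v ∈ W) :
    u - v ∈ W := by
  have e : u - v = u + (-1 : k) • v := by module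
  rw [e]
  exact W.add_mem hu (W.smul_mem _ hv)

lemma exists_finsupp_of_mem_Vminus {u : StT p k} (hu : u ∈ Vminus p k) :
    ∃ f : F p × F p →₀ k, (f.sum fun z c => c • (E p k z.1 ⊗ₜ[k] E p k z.2)) = u := by
  rw [← Finsupp.mem_span_range_iff_exists_finsupp]
  have hmem : ∀ x y : F p, E p k x ⊗ₜ[k] E p k y ∈
      Submodule.span k (Set.range fun z : F p × F p => E p k z.1 ⊗ₜ[k] E p k z.2) :=
    fun x y => Submodule.subset_span ⟨(x, y), rfl⟩
  refine Submodule.span_le.2 ?_ hu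
  rintro _ ⟨x, y, -, rfl⟩
  exact Submodule.smul_mem _ _ (sub_mem_StT p k (hmem x y) (hmem y x))

lemma coord₂_sum (f : F p × F p →₀ k) (a b : F p) :
    coord₂ p k a b (f.sum fun z c => c • (E p k z.1 ⊗ₜ[k] E p k z.2)) = f (a, b) := by
  classical
  rw [Finsupp.sum, map_sum, Finset.sum_eq_single (a, b)]
  · simp [coord₂_tmul, coord_E]
  · rintro ⟨x, y⟩ - h
    have : ¬ (x = a ∧ y = b) := by simpa using h
    rw [map_smul, coord₂_tmul, coord_E, coord_E]
    split_ifs <;> simp_all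
  · intro h
    simp [Finsupp.notMem_support_iff.1 h]

lemma eq_zero_of_coord₂_eq_zero {u : StT p k} (hu : u ∈ Vminus p k)
    (h0 : ∀ a b, coord₂ p k a b u = 0) : u = 0 := by
  obtain ⟨f, rfl⟩ := exists_finsupp_of_mem_Vminus p k hu
  have : f = 0 := by
    ext ⟨a, b⟩
    simpa [coord₂_sum] using h0 a b
  simp [this]

lemma coord₂_swap {u : StT p k} (hu : u ∈ Vminus p k) (a b : F p) :
    coord₂ p k a b u = -coord₂ p k b a u := by
  induction hu using Submodule.span_induction with
  | zero => simp
  | add u v _ _ hu hv => rw [map_add, map_add, hu, hv]; ring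
  | smul c u _ hu => rw [map_smul, map_smul, hu, smul_neg]
  | mem u hu =>
    obtain ⟨x, y, -, rfl⟩ := hu
    simp only [ρ, map_smul, map_sub, coord₂_tmul, smul_eq_mul]
    ring

lemma coord₂_self {u : StT p k} (hu : u ∈ Vminus p k) (a : F p) : coord₂ p k a a u = 0 :=
  self_eq_neg.1 (coord₂_swap p k hu a a)

lemma exists_vertices {u : StT p k} (hu : u ∈ Vminus p k) :
    ∃ S : Finset (F p), (∀ a ∉ S, ∀ b, coord₂ p k a b u = 0) ∧
      ∀ (g : G p) (a : F p), (∀ s ∈ S, coord p k a (gSt p k g (E p k s)) = 0) →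
        ∀ b, coord₂ p k a b (gTT p k g u) = 0 := by
  classical
  obtain ⟨f, rfl⟩ := exists_finsupp_of_mem_Vminus p k hu
  refine ⟨f.support.image Prod.fst, fun a ha b => ?_, fun g a ha b => ?_⟩
  · rw [coord₂_sum]
    by_contra h
    exact ha (Finset.mem_image.2 ⟨(a, b), Finsupp.mem_support_iff.2 h, rfl⟩)
  · rw [Finsupp.sum, map_sum, map_sum]
    refine Finset.sum_eq_zero fun z hz => ?_
    rw [map_smul, map_smul, gTT, TensorProduct.map_tmul, coord₂_tmul,
      ha _ (Finset.mem_image_of_mem _ hz), zero_mul, smul_zero]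

lemma ρ_mem_Vminus {x y : F p} (hxy : x ≠ y) : ρ p k x y ∈ Vminus p k :=
  Submodule.subset_span ⟨x, y, hxy, rfl⟩

lemma coord₂_zero_one_ρ : coord₂ p k 0 1 (ρ p k 0 1) = 2⁻¹ := by
  simp [ρ, coord₂_tmul, coord_E]

/-- An element of `V₋` satisfying all three-term relations satisfied by `ρ_{0,1}` is a
multiple of `ρ_{0,1}`. -/
lemma eq_smul_ρ {u : StT p k} (hu : u ∈ Vminus p k)
    (hrel : ∀ g₁ g₂ g₃ : G p,
      gTT p k g₁ (ρ p k 0 1) + gTT p k g₂ (ρ p k 0 1) = ρ p k 0 1 + gTT p k g₃ (ρ p k 0 1) →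
      gTT p k g₁ u + gTT p k g₂ u = u + gTT p k g₃ u) :
    ∃ c : k, u = c • ρ p k 0 1 := by
  classical
  obtain ⟨S, hS, hSg⟩ := exists_vertices p k hu
  obtain ⟨x, hx⟩ := Infinite.exists_notMem_finset
    ({0, 1} ∪ S ∪ (S ×ˢ S).image (fun z => z.1 * (1 - z.2) / (z.1 - z.2)) ∪
      (S ×ˢ S).image (fun z => z.1 / z.2) ∪ (S ×ˢ S).image (fun z => 1 + (z.1 - 1) / z.2))
  simp only [Finset.mem_union, Finset.mem_insert, Finset.mem_singleton, Finset.mem_image,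
    Finset.mem_product, Prod.exists, not_or, not_exists, not_and, and_imp] at hx
  obtain ⟨⟨⟨⟨⟨hx0, hx1⟩, hxS⟩, hx₁⟩, hx₂⟩, hx₃⟩ := hx
  obtain ⟨g₁, h₁0, h₁1, h₁⟩ := exists_moebius p k hx0 hx1
  obtain ⟨g₂, h₂0, h₂1, h₂⟩ := exists_affine p k (Ne.symm hx0)
  obtain ⟨g₃, h₃0, h₃1, h₃⟩ := exists_affine p k (Ne.symm hx1)
  have hrel' := hrel g₁ g₂ g₃ (by
    rw [gTT_ρ, gTT_ρ, gTT_ρ, h₁0, h₁1, h₂0, h₂1, h₃0, h₃1, ρ]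
    simp only [TensorProduct.sub_tmul, TensorProduct.tmul_sub]
    module)
  have hvanish : ∀ a, a ≠ 0 → a ≠ 1 → ∀ b, coord₂ p k a b u = 0 := by
    intro a ha0 ha1 b
    by_cases haS : a ∈ S
    · have := congrArg (coord₂ p k a b) hrel'
      rw [map_add, map_add, hSg g₁ a _ b, hSg g₂ a _ b, hSg g₃ a _ b, add_zero, add_zero] at this
      · exact this.symm
      · intro s hs
        by_contra hne
        have e := h₃ a s hne
        have hs0 : s ≠ 0 := by
          rintro rfl
          exact ha1 (by linear_combination -e)
        refine hx₃ a s haS hs ?_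
        field_simp
        linear_combination -e
      · intro s hs
        by_contra hne
        have e := h₂ a s hne
        have hs0 : s ≠ 0 := by
          rintro rfl
          exact ha0 (by linear_combination -e)
        refine hx₂ a s haS hs ?_
        field_simp
        linear_combination -e
      · intro s hs
        by_contra hne
        have e := h₁ a s (by rintro rfl; exact hxS haS) hne
        have has : a - s ≠ 0 := by
          intro h0
          obtain rfl := sub_eq_zero.1 h0
          exact mul_ne_zero ha0 (sub_ne_zero.2 ha1) (by linear_combination -e)
        refine hx₁ a s haS hs ?_
        field_simp
        linear_combination e
    · exact hS a haS b
  refine ⟨2 * coord₂ p k 0 1 u, sub_eq_zero.1 ?_⟩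
  have hρ := ρ_mem_Vminus p k (zero_ne_one (α := F p))
  have hmem := sub_mem_StT p k hu (Submodule.smul_mem (Vminus p k) (2 * coord₂ p k 0 1 u) hρ)
  have hvanish' : ∀ a, a ≠ 0 → a ≠ 1 → ∀ b, coord₂ p k a b (ρ p k 0 1) = 0 := by
    intro a ha0 ha1 b
    simp [ρ, coord₂_tmul, coord_E, ha0.symm, ha1.symm]
  have h01 : coord₂ p k 0 1 (u - (2 * coord₂ p k 0 1 u) • ρ p k 0 1) = 0 := by
    rw [map_sub, map_smul, coord₂_zero_one_ρ, smul_eq_mul]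
    field_simp
    ring
  have hout : ∀ a, a ≠ 0 → a ≠ 1 → ∀ b,
      coord₂ p k a b (u - (2 * coord₂ p k 0 1 u) • ρ p k 0 1) = 0 := by
    intro a ha0 ha1 b
    rw [map_sub, map_smul, hvanish a ha0 ha1, hvanish' a ha0 ha1, smul_zero, sub_zero]
  refine eq_zero_of_coord₂_eq_zero p k hmem fun a b => ?_
  by_cases ha : a ≠ 0 ∧ a ≠ 1
  · exact hout a ha.1 ha.2 b
  by_cases hb : b ≠ 0 ∧ b ≠ 1
  · rw [coord₂_swap p k hmem, hout b hb.1 hb.2 a, neg_zero]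
  have ha' : a = 0 ∨ a = 1 := by tauto
  have hb' : b = 0 ∨ b = 1 := by tauto
  rcases ha' with rfl | rfl <;> rcases hb' with rfl | rfl
  · exact coord₂_self p k hmem _
  · exact h01
  · rw [coord₂_swap p k hmem, h01, neg_zero]
  · exact coord₂_self p k hmem _

lemma exists_gTT_ρ {x y : F p} (hxy : x ≠ y) :
    ∃ g : G p, gTT p k g (ρ p k 0 1) = ρ p k x y := by
  obtain ⟨g, h0, h1, -⟩ := exists_affine p k hxy
  exact ⟨g, by rw [gTT_ρ, h0, h1, ρ]⟩

lemma eq_smul_of_eq_smul_on_generators {K M : Type*} [Field K] [AddCommMonoid M] [Module K M]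
    {s : Set M} (φ : Submodule.span K s →ₗ[K] Submodule.span K s) {c : K}
    (hφ : ∀ v (hv : v ∈ s), (φ ⟨v, Submodule.subset_span hv⟩ : M) = c • v) (v) :
    φ v = c • v := by
  obtain ⟨v, hv⟩ := v
  induction hv using Submodule.span_induction with
  | zero => exact (map_zero φ).trans (smul_zero c).symm
  | add u v hu hv h₁ h₂ =>
    have := map_add φ ⟨u, hu⟩ ⟨v, hv⟩
    rw [h₁, h₂, ← smul_add] at this
    exact this
  | smul r u hu h₁ =>
    have := map_smul φ r ⟨u, hu⟩
    rw [h₁, smul_comm] at this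
    exact this
  | mem v hv => exact Subtype.ext (hφ v hv)

lemma endomorphism_eq_smul
    (hstab : ∀ (g : G p) (v : StT p k), v ∈ Vminus p k → gTT p k g v ∈ Vminus p k)
    (φ : ↥(Vminus p k) →ₗ[k] ↥(Vminus p k))
    (hφ : ∀ (g : G p) (v : ↥(Vminus p k)),
      (φ ⟨gTT p k g (v : StT p k), hstab g v v.2⟩ : StT p k) = gTT p k g (φ v : StT p k)) :
    ∃ c : k, ∀ v, φ v = c • v := by
  have hρ := ρ_mem_Vminus p k (zero_ne_one (α := F p))
  obtain ⟨c, hc⟩ := eq_smul_ρ p k (φ ⟨_, hρ⟩).2 fun g₁ g₂ g₃ hg => by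
    let w (g : G p) : ↥(Vminus p k) := ⟨_, hstab g _ hρ⟩
    have e : w g₁ + w g₂ = ⟨_, hρ⟩ + w g₃ := Subtype.ext hg
    have := congrArg (fun z => (φ z : StT p k)) e
    simp only [map_add, Submodule.coe_add] at this
    rw [← hφ, ← hφ, ← hφ]
    exact this
  refine ⟨c, eq_smul_of_eq_smul_on_generators φ ?_⟩
  rintro _ ⟨x, y, hxy, rfl⟩
  obtain ⟨g, hg⟩ := exists_gTT_ρ p k hxy
  have := hφ g ⟨_, hρ⟩
  simp only [hg, hc, LinearMap.map_smul] at this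
  exact this

/-- A module (over a family of operators) all of whose endomorphisms are scalars is
indecomposable. -/
lemma eq_bot_or_eq_bot_of_forall_endomorphism_eq_smul {ι K M : Type*} [Field K] [AddCommMonoid M]
    [Module K M] {V : Submodule K M} {T : ι → M →ₗ[K] M}
    (hstab : ∀ g, ∀ v : M, v ∈ V → T g v ∈ V)
    (hend : ∀ φ : V →ₗ[K] V,
      (∀ (g : ι) (v : V), (φ ⟨T g (v : M), hstab g v v.2⟩ : M) = T g (φ v : M)) →
      ∃ c : K, ∀ v, φ v = c • v)
    {W₁ W₂ : Submodule K M} (hW₁ : ∀ g, ∀ v : M, v ∈ W₁ → T g v ∈ W₁)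
    (hW₂ : ∀ g, ∀ v : M, v ∈ W₂ → T g v ∈ W₂) (hsup : W₁ ⊔ W₂ = V) (hinf : W₁ ⊓ W₂ = ⊥) :
    W₁ = ⊥ ∨ W₂ = ⊥ := by
  let _ : AddCommGroup M := Module.addCommMonoidToAddCommGroup K
  have hle₁ : W₁ ≤ V := hsup ▸ le_sup_left
  have hle₂ : W₂ ≤ V := hsup ▸ le_sup_right
  have hcompl : IsCompl (W₁.comap V.subtype) (W₂.comap V.subtype) := by
    refine ⟨?_, ?_⟩
    · rw [disjoint_iff, ← Submodule.comap_inf, hinf, Submodule.comap_bot,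
        Submodule.ker_subtype]
    · rw [codisjoint_iff, eq_top_iff]
      rintro ⟨v, hv⟩ -
      have hv' := hv
      rw [← hsup] at hv'
      obtain ⟨w₁, h₁, w₂, h₂, rfl⟩ := Submodule.mem_sup.1 hv'
      exact Submodule.mem_sup.2 ⟨⟨w₁, hle₁ h₁⟩, h₁, ⟨w₂, hle₂ h₂⟩, h₂, rfl⟩
  obtain ⟨c, hc⟩ := hend (Submodule.projection _ _ hcompl) (by
    intro g v
    obtain ⟨w₁, h₁, w₂, h₂, rfl⟩ := Submodule.mem_sup.1
      (hcompl.sup_eq_top.symm ▸ Submodule.mem_top : v ∈ _ ⊔ _)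
    have e : (⟨T g (w₁ + w₂ : V), hstab g _ (w₁ + w₂).2⟩ : V) =
        ⟨T g w₁, hstab g _ w₁.2⟩ + ⟨T g w₂, hstab g _ w₂.2⟩ :=
      Subtype.ext (map_add (T g) _ _)
    rw [e, map_add, map_add, Submodule.projection_apply_of_mem_left hcompl h₁,
      Submodule.projection_apply_of_mem_left hcompl (hW₁ g _ h₁),
      (Submodule.projection_apply_eq_zero_iff hcompl).2 h₂,
      (Submodule.projection_apply_eq_zero_iff hcompl).2 (hW₂ g _ h₂), add_zero, add_zero])
  by_cases hc0 : c = 0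
  · left
    refine (Submodule.eq_bot_iff _).2 fun w hw => ?_
    have := hc ⟨w, hle₁ hw⟩
    rw [Submodule.projection_apply_of_mem_left hcompl hw, hc0, zero_smul] at this
    exact congrArg Subtype.val this
  · right
    refine (Submodule.eq_bot_iff _).2 fun w hw => ?_
    have := hc ⟨w, hle₂ hw⟩
    rw [(Submodule.projection_apply_eq_zero_iff hcompl).2 hw] at this
    exact congrArg Subtype.val ((smul_eq_zero.1 this.symm).resolve_left hc0)

/-- every `kG`-endomorphism of `V₋` is a scalar; consequently `V₋`
is indecomposable as a `kG`-module. -/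
theorem stmt8 (hp2 : p ≠ 2)
    (hstab : ∀ (g : G p) (v : StT p k), v ∈ Vminus p k → gTT p k g v ∈ Vminus p k) :
    (∀ φ : ↥(Vminus p k) →ₗ[k] ↥(Vminus p k),
      (∀ (g : G p) (v : ↥(Vminus p k)),
        (φ ⟨gTT p k g (v : StT p k), hstab g v v.2⟩ : StT p k) = gTT p k g (φ v : StT p k)) →
      ∃ c : k, ∀ v, φ v = c • v) ∧
    (∀ W₁ W₂ : Submodule k (StT p k),
      (∀ (g : G p) (v : StT p k), v ∈ W₁ → gTT p k g v ∈ W₁) →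
      (∀ (g : G p) (v : StT p k), v ∈ W₂ → gTT p k g v ∈ W₂) →
      W₁ ⊔ W₂ = Vminus p k → W₁ ⊓ W₂ = ⊥ → W₁ = ⊥ ∨ W₂ = ⊥) := by
  have hend := endomorphism_eq_smul p k hstab
  exact ⟨hend, fun _ _ hW₁ hW₂ =>
    eq_bot_or_eq_bot_of_forall_endomorphism_eq_smul hstab hend hW₁ hW₂⟩

end SL2X
end
end
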